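/- Suppose the limiting system (ODE-Λ) has a solution (Λ₁, Λ₂) on [0, T], let (S, r) be the unique solution of the limiting companion system (ODE-Sr), and define Θ, Θ₁, Θ₂ from (Λ₁, Λ₂, S). For N large, let (Λ₁^N, Λ₂^N) be the solution of (ODE-Λ^N) and (S^N, r^N) the solution of (ODE-S^N r^N), and define Θ^N, Θ₁^N, Θ₂^N from them. Then there exist N₁ ≥ 1 and C > 0 such that for all N ≥ N₁, sup_{t∈[0,T]} (|Θ^N(t) − Θ(t)| + |Θ₁^N(t) − Θ₁(t)| + |Θ₂^N(t) − Θ₂(t)|) ≤ C/N (|·| the Frobenius norm). -/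

import Mathlib

open Matrix Set

namespace LQ

/-- Frobenius norm of a real matrix. -/
noncomputable def frob {a b : Type*} [Fintype a] [Fintype b] (M : Matrix a b ℝ) : ℝ :=
  Real.sqrt (∑ i, ∑ j, (M i j) ^ 2)

/-- Entrywise ℓ₁ norm of a real matrix. -/
noncomputable def l1norm {a b : Type*} [Fintype a] [Fintype b] (M : Matrix a b ℝ) : ℝ :=
  ∑ i, ∑ j, |M i j|

/-- Block matrix with all diagonal m×m blocks equal to `F` and all off-diagonal blocks equal to `K`. -/
def blockConst (N m : ℕ) (F K : Matrix (Fin m) (Fin m) ℝ) :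
    Matrix (Fin N × Fin m) (Fin N × Fin m) ℝ :=
  Matrix.of fun x y => if x.1 = y.1 then F x.2 y.2 else K x.2 y.2

/-- Block matrix with diagonal blocks `Λ₁` and off-diagonal blocks `Λ₂ / N`. -/
noncomputable def blockPN (N n : ℕ) (Λ₁ Λ₂ : Matrix (Fin n) (Fin n) ℝ) :
    Matrix (Fin N × Fin n) (Fin N × Fin n) ℝ :=
  Matrix.of fun x y => if x.1 = y.1 then Λ₁ x.2 y.2 else Λ₂ x.2 y.2 / (N : ℝ)

/-- The permutation matrix exchanging the i-th and j-th block rows of `I_{Nn}`. -/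
def Jswap (N n : ℕ) (i j : Fin N) : Matrix (Fin N × Fin n) (Fin N × Fin n) ℝ :=
  Matrix.of fun x y => if y.1 = Equiv.swap i j x.1 ∧ y.2 = x.2 then 1 else 0

/-- `I_N ⊗ M`. -/
def kronIN (N : ℕ) {a b : ℕ} (M : Matrix (Fin a) (Fin b) ℝ) :
    Matrix (Fin N × Fin a) (Fin N × Fin b) ℝ :=
  Matrix.of fun x y => if x.1 = y.1 then M x.2 y.2 else 0

/-- `𝟏_{N×1} ⊗ M`. -/
def stackN (N : ℕ) {a b : ℕ} (M : Matrix (Fin a) (Fin b) ℝ) :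
    Matrix (Fin N × Fin a) (Fin b) ℝ :=
  Matrix.of fun x y => M x.2 y

/-- Data of the LQ mean field social optimization problem. -/
structure Params (n n₁ : ℕ) where
  A : Matrix (Fin n) (Fin n) ℝ
  G : Matrix (Fin n) (Fin n) ℝ
  Γ : Matrix (Fin n) (Fin n) ℝ
  Γf : Matrix (Fin n) (Fin n) ℝ
  B : Matrix (Fin n) (Fin n₁) ℝ
  B0 : Matrix (Fin n) (Fin n₁) ℝ
  B1 : Matrix (Fin n) (Fin n₁) ℝ
  D : Matrix (Fin n) (Fin 1) ℝ
  D0 : Matrix (Fin n) (Fin 1) ℝ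
  Q : Matrix (Fin n) (Fin n) ℝ
  Qf : Matrix (Fin n) (Fin n) ℝ
  R : Matrix (Fin n₁) (Fin n₁) ℝ
  T : ℝ

namespace Params

variable {n n₁ : ℕ} (p : Params n n₁)

/-- Standing hypotheses: positive dimensions, positive horizon, symmetric weights. -/
def Standing : Prop :=
  1 ≤ n ∧ 1 ≤ n₁ ∧ 0 < p.T ∧ p.Q.IsSymm ∧ p.Qf.IsSymm ∧ p.R.IsSymm

/-- Q^Γ = Γᵀ Q Γ − Q Γ − Γᵀ Q. -/
def QΓ : Matrix (Fin n) (Fin n) ℝ := p.Γᵀ * p.Q * p.Γ - p.Q * p.Γ - p.Γᵀ * p.Q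

/-- Q_f^Γ = Γ_fᵀ Q_f Γ_f − Q_f Γ_f − Γ_fᵀ Q_f. -/
def QfΓ : Matrix (Fin n) (Fin n) ℝ := p.Γfᵀ * p.Qf * p.Γf - p.Qf * p.Γf - p.Γfᵀ * p.Qf

/-- ℛ₁(Λ₁) = R + B₁ᵀ Λ₁ B₁. -/
def R1 (Λ₁ : Matrix (Fin n) (Fin n) ℝ) : Matrix (Fin n₁) (Fin n₁) ℝ :=
  p.R + p.B1ᵀ * Λ₁ * p.B1

/-- ℛ₂(Λ₁,Λ₂) = R + B₁ᵀ Λ₁ B₁ + B₀ᵀ(Λ₁+Λ₂)B₀. -/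
def R2 (Λ₁ Λ₂ : Matrix (Fin n) (Fin n) ℝ) : Matrix (Fin n₁) (Fin n₁) ℝ :=
  p.R + p.B1ᵀ * Λ₁ * p.B1 + p.B0ᵀ * (Λ₁ + Λ₂) * p.B0

/-- Ψ₁. -/
noncomputable def Ψ₁ (Λ₁ : Matrix (Fin n) (Fin n) ℝ) : Matrix (Fin n) (Fin n) ℝ :=
  Λ₁ * p.B * (p.R1 Λ₁)⁻¹ * p.Bᵀ * Λ₁ - Λ₁ * p.A - p.Aᵀ * Λ₁ - p.Q

/-- Ψ₂. -/
noncomputable def Ψ₂ (Λ₁ Λ₂ : Matrix (Fin n) (Fin n) ℝ) : Matrix (Fin n) (Fin n) ℝ :=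
  (Λ₁ + Λ₂) * p.B * (p.R2 Λ₁ Λ₂)⁻¹ * p.Bᵀ * (Λ₁ + Λ₂)
    - Λ₁ * p.B * (p.R1 Λ₁)⁻¹ * p.Bᵀ * Λ₁
    - (Λ₁ * p.G + Λ₂ * (p.A + p.G))
    - (p.Gᵀ * Λ₁ + (p.Aᵀ + p.Gᵀ) * Λ₂)
    - p.QΓ

/-- Solution of the limiting ODE system (ODE-Λ) on [0,T]. -/
noncomputable def IsSolLim (Λ₁ Λ₂ : ℝ → Matrix (Fin n) (Fin n) ℝ) : Prop :=
  (∀ t ∈ Icc (0 : ℝ) p.T, (Λ₁ t).IsSymm ∧ (Λ₂ t).IsSymm) ∧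
  (∀ t ∈ Icc (0 : ℝ) p.T, (p.R1 (Λ₁ t)).PosDef ∧ (p.R2 (Λ₁ t) (Λ₂ t)).PosDef) ∧
  Λ₁ p.T = p.Qf ∧ Λ₂ p.T = p.QfΓ ∧
  (∀ t ∈ Icc (0 : ℝ) p.T, ∀ i j, HasDerivWithinAt (fun s => Λ₁ s i j)
    (p.Ψ₁ (Λ₁ t) i j) (Icc (0 : ℝ) p.T) t) ∧
  (∀ t ∈ Icc (0 : ℝ) p.T, ∀ i j, HasDerivWithinAt (fun s => Λ₂ s i j)
    (p.Ψ₂ (Λ₁ t) (Λ₂ t) i j) (Icc (0 : ℝ) p.T) t)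

/-! Big (N-agent) matrices. -/

noncomputable def bigA (N : ℕ) : Matrix (Fin N × Fin n) (Fin N × Fin n) ℝ :=
  Matrix.of fun x y => (if x.1 = y.1 then p.A x.2 y.2 else 0) + p.G x.2 y.2 / (N : ℝ)

def bigBhat (N : ℕ) : Matrix (Fin N × Fin n) (Fin N × Fin n₁) ℝ :=
  Matrix.of fun x y => if x.1 = y.1 then p.B x.2 y.2 else 0

def bigB (N : ℕ) (i : Fin N) : Matrix (Fin N × Fin n) (Fin n₁) ℝ :=
  Matrix.of fun x l => if x.1 = i then p.B1 x.2 l else 0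

noncomputable def bigB0 (N : ℕ) : Matrix (Fin N × Fin n) (Fin n₁) ℝ :=
  Matrix.of fun x l => p.B0 x.2 l / (N : ℝ)

def bigD (N : ℕ) (i : Fin N) : Matrix (Fin N × Fin n) (Fin 1) ℝ :=
  Matrix.of fun x l => if x.1 = i then p.D x.2 l else 0

def bigD0 (N : ℕ) : Matrix (Fin N × Fin n) (Fin 1) ℝ :=
  Matrix.of fun x l => p.D0 x.2 l

def bigE (_p : Params n n₁) (N : ℕ) (i : Fin N) : Matrix (Fin n₁) (Fin N × Fin n₁) ℝ :=
  Matrix.of fun k y => if y.1 = i ∧ y.2 = k then 1 else 0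

def bigIhat (_p : Params n n₁) (N : ℕ) : Matrix (Fin n₁) (Fin N × Fin n₁) ℝ :=
  Matrix.of fun k y => if y.2 = k then 1 else 0

noncomputable def bigQ (N : ℕ) : Matrix (Fin N × Fin n) (Fin N × Fin n) ℝ :=
  Matrix.of fun x y => (if x.1 = y.1 then p.Q x.2 y.2 else 0) + p.QΓ x.2 y.2 / (N : ℝ)

noncomputable def bigQf (N : ℕ) : Matrix (Fin N × Fin n) (Fin N × Fin n) ℝ :=
  Matrix.of fun x y => (if x.1 = y.1 then p.Qf x.2 y.2 else 0) + p.QfΓ x.2 y.2 / (N : ℝ)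

def bigR (N : ℕ) : Matrix (Fin N × Fin n₁) (Fin N × Fin n₁) ℝ :=
  Matrix.of fun x y => if x.1 = y.1 then p.R x.2 y.2 else 0

/-- 𝓜₀. -/
noncomputable def M0 (N : ℕ) (Z : Matrix (Fin N × Fin n) (Fin N × Fin n) ℝ) :
    Matrix (Fin 1) (Fin 1) ℝ :=
  (1 / 2 : ℝ) • (∑ i : Fin N, (p.bigD N i)ᵀ * Z * p.bigD N i)
    + (1 / 2 : ℝ) • ((p.bigD0 N)ᵀ * Z * p.bigD0 N)

/-- 𝓜₁. -/
noncomputable def M1 (N : ℕ) (Z : Matrix (Fin N × Fin n) (Fin N × Fin n) ℝ) :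
    Matrix (Fin 1) (Fin N × Fin n₁) ℝ :=
  (∑ i : Fin N, (p.bigD N i)ᵀ * Z * p.bigB N i * p.bigE N i)
    + (p.bigD0 N)ᵀ * Z * p.bigB0 N * p.bigIhat N

/-- 𝓜₂. -/
noncomputable def M2 (N : ℕ) (Z : Matrix (Fin N × Fin n) (Fin N × Fin n) ℝ) :
    Matrix (Fin N × Fin n₁) (Fin N × Fin n₁) ℝ :=
  (1 / 2 : ℝ) • (∑ i : Fin N, (p.bigE N i)ᵀ * (p.bigB N i)ᵀ * Z * p.bigB N i * p.bigE N i)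
    + (1 / 2 : ℝ) • ((p.bigIhat N)ᵀ * (p.bigB0 N)ᵀ * Z * p.bigB0 N * p.bigIhat N)

/-- Right-hand side of the Riccati equation (ODE-P). -/
noncomputable def PRic (N : ℕ) (P : Matrix (Fin N × Fin n) (Fin N × Fin n) ℝ) :
    Matrix (Fin N × Fin n) (Fin N × Fin n) ℝ :=
  P * p.bigBhat N * (p.bigR N + (2 : ℝ) • p.M2 N P)⁻¹ * (p.bigBhat N)ᵀ * P
    - P * p.bigA N - (p.bigA N)ᵀ * P - p.bigQ N

/-- Solution of the large-scale Riccati equation (ODE-P) on [0,T]. -/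
noncomputable def IsSolP (N : ℕ) (P : ℝ → Matrix (Fin N × Fin n) (Fin N × Fin n) ℝ) : Prop :=
  (∀ t ∈ Icc (0 : ℝ) p.T, (P t).IsSymm) ∧
  (∀ t ∈ Icc (0 : ℝ) p.T, (p.bigR N + (2 : ℝ) • p.M2 N (P t)).PosDef) ∧
  P p.T = p.bigQf N ∧
  (∀ t ∈ Icc (0 : ℝ) p.T, ∀ x y, HasDerivWithinAt (fun s => P s x y)
    (p.PRic N (P t) x y) (Icc (0 : ℝ) p.T) t)

/-- Solution of the companion linear equation (ODE-S) on [0,T], relative to `P`. -/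
noncomputable def IsSolS (N : ℕ) (P : ℝ → Matrix (Fin N × Fin n) (Fin N × Fin n) ℝ)
    (S : ℝ → Matrix (Fin N × Fin n) (Fin 1) ℝ) : Prop :=
  S p.T = 0 ∧
  (∀ t ∈ Icc (0 : ℝ) p.T, ∀ x y, HasDerivWithinAt (fun s => S s x y)
    ((P t * p.bigBhat N * (p.bigR N + (2 : ℝ) • p.M2 N (P t))⁻¹ *
        ((p.bigBhat N)ᵀ * S t + (p.M1 N (P t))ᵀ) - (p.bigA N)ᵀ * S t) x y)
    (Icc (0 : ℝ) p.T) t)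

/-- Solution of the companion scalar equation (ODE-r) on [0,T], relative to `P` and `S`. -/
noncomputable def IsSolr (N : ℕ) (P : ℝ → Matrix (Fin N × Fin n) (Fin N × Fin n) ℝ)
    (S : ℝ → Matrix (Fin N × Fin n) (Fin 1) ℝ) (r : ℝ → ℝ) : Prop :=
  r p.T = 0 ∧
  (∀ t ∈ Icc (0 : ℝ) p.T, HasDerivWithinAt r
    (((((S t)ᵀ * p.bigBhat N + p.M1 N (P t)) * (p.bigR N + (2 : ℝ) • p.M2 N (P t))⁻¹ *
        ((p.bigBhat N)ᵀ * S t + (p.M1 N (P t))ᵀ)) - (2 : ℝ) • p.M0 N (P t)) 0 0)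
    (Icc (0 : ℝ) p.T) t)

/-- Asymptotic solvability of the LQ mean field social optimization problem. -/
noncomputable def AsympSolvable : Prop :=
  ∃ N₀ : ℕ, 1 ≤ N₀ ∧ ∃ c₀ : ℝ, 0 < c₀ ∧ ∃ C : ℝ,
    ∀ N : ℕ, N₀ ≤ N →
      ∃ P : ℝ → Matrix (Fin N × Fin n) (Fin N × Fin n) ℝ,
        p.IsSolP N P ∧
        (∀ t ∈ Icc (0 : ℝ) p.T, l1norm (P t) / (N : ℝ) ≤ C) ∧
        (∀ t ∈ Icc (0 : ℝ) p.T,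
          (p.bigR N + (2 : ℝ) • p.M2 N (P t) - c₀ • 1).PosSemidef)

/-! The rescaled low-dimensional system. -/

/-- E^N. -/
noncomputable def EN (N : ℕ) (Λ₁ Λ₂ : Matrix (Fin n) (Fin n) ℝ) :
    Matrix (Fin n₁) (Fin n₁) ℝ :=
  (1 / (N : ℝ)) •
    ((p.R2 Λ₁ Λ₂ - (1 / (N : ℝ)) • (p.B0ᵀ * Λ₂ * p.B0))⁻¹ - (p.R1 Λ₁)⁻¹)

/-- H^N. -/
noncomputable def HN (N : ℕ) (Λ₁ Λ₂ : Matrix (Fin n) (Fin n) ℝ) :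
    Matrix (Fin n₁) (Fin n₁) ℝ :=
  p.EN N Λ₁ Λ₂ + (p.R1 Λ₁)⁻¹

/-- g₁. -/
noncomputable def g₁ (N : ℕ) (Λ₁ Λ₂ : Matrix (Fin n) (Fin n) ℝ) :
    Matrix (Fin n) (Fin n) ℝ :=
  Λ₁ * p.B * p.EN N Λ₁ Λ₂ * p.Bᵀ * Λ₁
  + (1 - 1 / (N : ℝ)) •
      (Λ₂ * p.B * p.EN N Λ₁ Λ₂ * p.Bᵀ * Λ₁ + Λ₁ * p.B * p.EN N Λ₁ Λ₂ * p.Bᵀ * Λ₂)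
  + (1 / (N : ℝ) - 1 / (N : ℝ) ^ 2) •
      (Λ₂ * p.B * (p.HN N Λ₁ Λ₂ + ((N : ℝ) - 2) • p.EN N Λ₁ Λ₂) * p.Bᵀ * Λ₂)
  - (1 / (N : ℝ)) •
      ((Λ₁ * p.G + p.Gᵀ * Λ₁) + (1 - 1 / (N : ℝ)) • (Λ₂ * p.G + p.Gᵀ * Λ₂))
  - (1 / (N : ℝ)) • p.QΓ

/-- g₂. -/
noncomputable def g₂ (N : ℕ) (Λ₁ Λ₂ : Matrix (Fin n) (Fin n) ℝ) :
    Matrix (Fin n) (Fin n) ℝ :=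
  (Λ₁ + Λ₂) * p.B *
      ((N : ℝ) • p.EN N Λ₁ Λ₂ + (p.R1 Λ₁)⁻¹ - (p.R2 Λ₁ Λ₂)⁻¹) * p.Bᵀ * (Λ₁ + Λ₂)
  - (2 / (N : ℝ)) • (Λ₂ * p.B * (p.R1 Λ₁)⁻¹ * p.Bᵀ * Λ₂)
  + (1 / (N : ℝ) - 2) • (Λ₂ * p.B * p.EN N Λ₁ Λ₂ * p.Bᵀ * Λ₂)
  - Λ₁ * p.B * p.EN N Λ₁ Λ₂ * p.Bᵀ * Λ₂
  - Λ₂ * p.B * p.EN N Λ₁ Λ₂ * p.Bᵀ * Λ₁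
  + (1 / (N : ℝ)) • (Λ₂ * p.G + p.Gᵀ * Λ₂)

/-- Solution of the rescaled system (ODE-Λ^N) on [0,T]. -/
noncomputable def IsSolLamN (N : ℕ) (Λ₁ Λ₂ : ℝ → Matrix (Fin n) (Fin n) ℝ) : Prop :=
  (∀ t ∈ Icc (0 : ℝ) p.T, (Λ₁ t).IsSymm ∧ (Λ₂ t).IsSymm) ∧
  (∀ t ∈ Icc (0 : ℝ) p.T, (p.R1 (Λ₁ t)).PosDef ∧ (p.R2 (Λ₁ t) (Λ₂ t)).PosDef ∧
    (p.R2 (Λ₁ t) (Λ₂ t) - (1 / (N : ℝ)) • (p.B0ᵀ * Λ₂ t * p.B0)).PosDef) ∧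
  Λ₁ p.T = p.Qf + (1 / (N : ℝ)) • p.QfΓ ∧ Λ₂ p.T = p.QfΓ ∧
  (∀ t ∈ Icc (0 : ℝ) p.T, ∀ i j, HasDerivWithinAt (fun s => Λ₁ s i j)
    ((p.Ψ₁ (Λ₁ t) + p.g₁ N (Λ₁ t) (Λ₂ t)) i j) (Icc (0 : ℝ) p.T) t) ∧
  (∀ t ∈ Icc (0 : ℝ) p.T, ∀ i j, HasDerivWithinAt (fun s => Λ₂ s i j)
    ((p.Ψ₂ (Λ₁ t) (Λ₂ t) + p.g₂ N (Λ₁ t) (Λ₂ t)) i j) (Icc (0 : ℝ) p.T) t)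

/-! Companion (mean-field) equations. -/

/-- φ₁. -/
noncomputable def φ₁ (Λ₁ Λ₂ : Matrix (Fin n) (Fin n) ℝ) (S : Matrix (Fin n) (Fin 1) ℝ) :
    Matrix (Fin n) (Fin 1) ℝ :=
  (Λ₁ + Λ₂) * p.B * (p.R2 Λ₁ Λ₂)⁻¹ *
      (p.Bᵀ * S + p.B1ᵀ * Λ₁ * p.D + p.B0ᵀ * (Λ₁ + Λ₂) * p.D0)
    - (p.A + p.G)ᵀ * S

/-- φ₂. -/
noncomputable def φ₂ (Λ₁ Λ₂ : Matrix (Fin n) (Fin n) ℝ) (S : Matrix (Fin n) (Fin 1) ℝ) :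
    Matrix (Fin 1) (Fin 1) ℝ :=
  (Sᵀ * p.B + p.Dᵀ * Λ₁ * p.B1 + p.D0ᵀ * (Λ₁ + Λ₂) * p.B0) * (p.R2 Λ₁ Λ₂)⁻¹ *
      (p.Bᵀ * S + p.B1ᵀ * Λ₁ * p.D + p.B0ᵀ * (Λ₁ + Λ₂) * p.D0)
    - p.Dᵀ * Λ₁ * p.D - p.D0ᵀ * (Λ₁ + Λ₂) * p.D0

/-- Solution of the limiting companion system (ODE-Sr) on [0,T]. -/
noncomputable def IsSolSr (Λ₁ Λ₂ : ℝ → Matrix (Fin n) (Fin n) ℝ)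
    (S : ℝ → Matrix (Fin n) (Fin 1) ℝ) (r : ℝ → ℝ) : Prop :=
  S p.T = 0 ∧ r p.T = 0 ∧
  (∀ t ∈ Icc (0 : ℝ) p.T, ∀ i j, HasDerivWithinAt (fun s => S s i j)
    (p.φ₁ (Λ₁ t) (Λ₂ t) (S t) i j) (Icc (0 : ℝ) p.T) t) ∧
  (∀ t ∈ Icc (0 : ℝ) p.T, HasDerivWithinAt r
    ((p.φ₂ (Λ₁ t) (Λ₂ t) (S t)) 0 0) (Icc (0 : ℝ) p.T) t)

/-- g₀₁. -/
noncomputable def g01 (N : ℕ) (Λ₁ Λ₂ : Matrix (Fin n) (Fin n) ℝ)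
    (S : Matrix (Fin n) (Fin 1) ℝ) : Matrix (Fin n) (Fin 1) ℝ :=
  (Λ₁ + (1 - 1 / (N : ℝ)) • Λ₂) * p.B *
      (p.R2 Λ₁ Λ₂ - (1 / (N : ℝ)) • (p.B0ᵀ * Λ₂ * p.B0))⁻¹ *
      (p.Bᵀ * S + p.B1ᵀ * Λ₁ * p.D + p.B0ᵀ * (Λ₁ + (1 - 1 / (N : ℝ)) • Λ₂) * p.D0)
  - (Λ₁ + Λ₂) * p.B * (p.R2 Λ₁ Λ₂)⁻¹ *
      (p.Bᵀ * S + p.B1ᵀ * Λ₁ * p.D + p.B0ᵀ * (Λ₁ + Λ₂) * p.D0)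

/-- g₀₂. -/
noncomputable def g02 (N : ℕ) (Λ₁ Λ₂ : Matrix (Fin n) (Fin n) ℝ)
    (S : Matrix (Fin n) (Fin 1) ℝ) : Matrix (Fin 1) (Fin 1) ℝ :=
  (Sᵀ * p.B + p.Dᵀ * Λ₁ * p.B1 + p.D0ᵀ * (Λ₁ + (1 - 1 / (N : ℝ)) • Λ₂) * p.B0) *
      (p.R2 Λ₁ Λ₂ - (1 / (N : ℝ)) • (p.B0ᵀ * Λ₂ * p.B0))⁻¹ *
      (p.Bᵀ * S + p.B1ᵀ * Λ₁ * p.D + p.B0ᵀ * (Λ₁ + (1 - 1 / (N : ℝ)) • Λ₂) * p.D0)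
  - (Sᵀ * p.B + p.Dᵀ * Λ₁ * p.B1 + p.D0ᵀ * (Λ₁ + Λ₂) * p.B0) * (p.R2 Λ₁ Λ₂)⁻¹ *
      (p.Bᵀ * S + p.B1ᵀ * Λ₁ * p.D + p.B0ᵀ * (Λ₁ + Λ₂) * p.D0)
  + (1 / (N : ℝ)) • (p.D0ᵀ * Λ₂ * p.D0)

/-- Solution of the rescaled companion system (ODE-S^N r^N) on [0,T]. -/
noncomputable def IsSolSrN (N : ℕ) (Λ₁ Λ₂ : ℝ → Matrix (Fin n) (Fin n) ℝ)
    (S : ℝ → Matrix (Fin n) (Fin 1) ℝ) (r : ℝ → ℝ) : Prop :=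
  S p.T = 0 ∧ r p.T = 0 ∧
  (∀ t ∈ Icc (0 : ℝ) p.T, ∀ i j, HasDerivWithinAt (fun s => S s i j)
    ((p.φ₁ (Λ₁ t) (Λ₂ t) (S t) + p.g01 N (Λ₁ t) (Λ₂ t) (S t)) i j) (Icc (0 : ℝ) p.T) t) ∧
  (∀ t ∈ Icc (0 : ℝ) p.T, HasDerivWithinAt r
    ((p.φ₂ (Λ₁ t) (Λ₂ t) (S t) + p.g02 N (Λ₁ t) (Λ₂ t) (S t)) 0 0) (Icc (0 : ℝ) p.T) t)

/-! Feedback gains. -/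

/-- Θ = ℛ₁(Λ₁)⁻¹ Bᵀ Λ₁. -/
noncomputable def Theta (Λ₁ : Matrix (Fin n) (Fin n) ℝ) : Matrix (Fin n₁) (Fin n) ℝ :=
  (p.R1 Λ₁)⁻¹ * p.Bᵀ * Λ₁

/-- Θ₁ = (H₁ − H)Bᵀ(Λ₁+Λ₂) + HBᵀΛ₂. -/
noncomputable def Theta1 (Λ₁ Λ₂ : Matrix (Fin n) (Fin n) ℝ) : Matrix (Fin n₁) (Fin n) ℝ :=
  ((p.R2 Λ₁ Λ₂)⁻¹ - (p.R1 Λ₁)⁻¹) * p.Bᵀ * (Λ₁ + Λ₂) + (p.R1 Λ₁)⁻¹ * p.Bᵀ * Λ₂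

/-- Θ₂ = H₁[BᵀS + B₁ᵀΛ₁D + B₀ᵀ(Λ₁+Λ₂)D₀]. -/
noncomputable def Theta2 (Λ₁ Λ₂ : Matrix (Fin n) (Fin n) ℝ) (S : Matrix (Fin n) (Fin 1) ℝ) :
    Matrix (Fin n₁) (Fin 1) ℝ :=
  (p.R2 Λ₁ Λ₂)⁻¹ * (p.Bᵀ * S + p.B1ᵀ * Λ₁ * p.D + p.B0ᵀ * (Λ₁ + Λ₂) * p.D0)

/-- Θ^N. -/
noncomputable def ThetaN (N : ℕ) (Λ₁ Λ₂ : Matrix (Fin n) (Fin n) ℝ) :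
    Matrix (Fin n₁) (Fin n) ℝ :=
  (p.HN N Λ₁ Λ₂ - p.EN N Λ₁ Λ₂) * p.Bᵀ * (Λ₁ - (1 / (N : ℝ)) • Λ₂)

/-- Θ₁^N. -/
noncomputable def Theta1N (N : ℕ) (Λ₁ Λ₂ : Matrix (Fin n) (Fin n) ℝ) :
    Matrix (Fin n₁) (Fin n) ℝ :=
  (N : ℝ) • (p.EN N Λ₁ Λ₂ * p.Bᵀ * Λ₁)
    + (p.HN N Λ₁ Λ₂ + ((N : ℝ) - 2) • p.EN N Λ₁ Λ₂) * p.Bᵀ * Λ₂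

/-- Θ₂^N. -/
noncomputable def Theta2N (N : ℕ) (Λ₁ Λ₂ : Matrix (Fin n) (Fin n) ℝ)
    (S : Matrix (Fin n) (Fin 1) ℝ) : Matrix (Fin n₁) (Fin 1) ℝ :=
  (p.HN N Λ₁ Λ₂ + ((N : ℝ) - 1) • p.EN N Λ₁ Λ₂) *
    (p.Bᵀ * S + p.B1ᵀ * Λ₁ * p.D + p.B0ᵀ * (Λ₁ + (1 - 1 / (N : ℝ)) • Λ₂) * p.D0)

/-- Z₀ = −B₀(Θ + Θ₁). -/
noncomputable def Z0 (Λ₁ Λ₂ : Matrix (Fin n) (Fin n) ℝ) : Matrix (Fin n) (Fin n) ℝ :=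
  -(p.B0 * (p.Theta Λ₁ + p.Theta1 Λ₁ Λ₂))

/-- Z₁ = A + G − B(Θ + Θ₁). -/
noncomputable def Z1 (Λ₁ Λ₂ : Matrix (Fin n) (Fin n) ℝ) : Matrix (Fin n) (Fin n) ℝ :=
  p.A + p.G - p.B * (p.Theta Λ₁ + p.Theta1 Λ₁ Λ₂)

/-! The high-dimensional equations under the decentralized control. -/

/-- RHS of (ODE-P̌₁) (paper's −d𝐏̌₁/dt). -/
noncomputable def Pcheck1RHS (N : ℕ) (Θ : Matrix (Fin n₁) (Fin n) ℝ)
    (P1 : Matrix (Fin N × Fin n) (Fin N × Fin n) ℝ) :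
    Matrix (Fin N × Fin n) (Fin N × Fin n) ℝ :=
  (kronIN N Θ)ᵀ * (p.bigR N + p.M2 N ((2 : ℝ) • P1)) * kronIN N Θ
    + P1 * (p.bigA N - p.bigBhat N * kronIN N Θ)
    + (p.bigA N - p.bigBhat N * kronIN N Θ)ᵀ * P1
    + p.bigQ N

/-- Solution of (ODE-P̌₁) on [0,T], with Θ(t) built from Λ₁(t). -/
noncomputable def IsSolPcheck1 (N : ℕ) (Λ₁ : ℝ → Matrix (Fin n) (Fin n) ℝ)
    (P1 : ℝ → Matrix (Fin N × Fin n) (Fin N × Fin n) ℝ) : Prop :=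
  P1 p.T = p.bigQf N ∧
  (∀ t ∈ Icc (0 : ℝ) p.T, ∀ x y, HasDerivWithinAt (fun s => P1 s x y)
    ((-(p.Pcheck1RHS N (p.Theta (Λ₁ t)) (P1 t))) x y) (Icc (0 : ℝ) p.T) t)

/-- RHS of (ODE-P̌₁₂) (paper's −d𝐏̌₁₂/dt). -/
noncomputable def Pcheck12RHS (N : ℕ) (Λ₁m Λ₂m : Matrix (Fin n) (Fin n) ℝ)
    (P1 : Matrix (Fin N × Fin n) (Fin N × Fin n) ℝ)
    (P12 : Matrix (Fin N × Fin n) (Fin n) ℝ) :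
    Matrix (Fin N × Fin n) (Fin n) ℝ :=
  (kronIN N (p.Theta Λ₁m))ᵀ * (p.bigR N + p.M2 N ((2 : ℝ) • P1)) *
      stackN N (p.Theta1 Λ₁m Λ₂m)
    - P1 * p.bigBhat N * stackN N (p.Theta1 Λ₁m Λ₂m)
    + ((p.bigA N)ᵀ - (kronIN N (p.Theta Λ₁m))ᵀ * (p.bigBhat N)ᵀ) * P12
    + P12 * p.Z1 Λ₁m Λ₂m
    - (kronIN N (p.Theta Λ₁m))ᵀ * (p.bigIhat N)ᵀ * (p.bigB0 N)ᵀ * P12 * p.Z0 Λ₁m Λ₂m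

/-- Solution of (ODE-P̌₁₂) on [0,T]. -/
noncomputable def IsSolPcheck12 (N : ℕ) (Λ₁ Λ₂ : ℝ → Matrix (Fin n) (Fin n) ℝ)
    (P1 : ℝ → Matrix (Fin N × Fin n) (Fin N × Fin n) ℝ)
    (P12 : ℝ → Matrix (Fin N × Fin n) (Fin n) ℝ) : Prop :=
  P12 p.T = 0 ∧
  (∀ t ∈ Icc (0 : ℝ) p.T, ∀ x y, HasDerivWithinAt (fun s => P12 s x y)
    ((-(p.Pcheck12RHS N (Λ₁ t) (Λ₂ t) (P1 t) (P12 t))) x y) (Icc (0 : ℝ) p.T) t)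

/-! The decentralized-control low-dimensional coefficient system. -/

/-- ǧ₁. -/
noncomputable def gc1 (N : ℕ) (Θ : Matrix (Fin n₁) (Fin n) ℝ)
    (L1 L2 : Matrix (Fin n) (Fin n) ℝ) : Matrix (Fin n) (Fin n) ℝ :=
  (1 / (N : ℝ)) •
    (Θᵀ * p.B0ᵀ * (L1 + (1 - 1 / (N : ℝ)) • L2) * p.B0 * Θ
      + (L1 + (1 - 1 / (N : ℝ)) • L2) * p.G
      + p.Gᵀ * (L1 + (1 - 1 / (N : ℝ)) • L2)
      + p.QΓ)

/-- ǧ₂. -/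
noncomputable def gc2 (N : ℕ) (Θ : Matrix (Fin n₁) (Fin n) ℝ)
    (L2 : Matrix (Fin n) (Fin n) ℝ) : Matrix (Fin n) (Fin n) ℝ :=
  -((1 / (N : ℝ)) • (Θᵀ * p.B0ᵀ * L2 * p.B0 * Θ + L2 * p.G + p.Gᵀ * L2))

/-- ǧ₁₂. -/
noncomputable def gc12 (N : ℕ) (Θ Θ₁ : Matrix (Fin n₁) (Fin n) ℝ)
    (L2 : Matrix (Fin n) (Fin n) ℝ) : Matrix (Fin n) (Fin n) ℝ :=
  (1 / (N : ℝ)) • (-(Θᵀ * p.B0ᵀ * L2 * p.B0 * Θ₁) + L2 * p.B * Θ₁)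

/-- ǧ₂₂. -/
noncomputable def gc22 (N : ℕ) (Θ₁ : Matrix (Fin n₁) (Fin n) ℝ)
    (L2 : Matrix (Fin n) (Fin n) ℝ) : Matrix (Fin n) (Fin n) ℝ :=
  -((1 / (N : ℝ)) • (Θ₁ᵀ * p.B0ᵀ * L2 * p.B0 * Θ₁))

/-- ǧ₀₁. -/
noncomputable def gc01 (N : ℕ) (Θ : Matrix (Fin n₁) (Fin n) ℝ)
    (Θ₂ : Matrix (Fin n₁) (Fin 1) ℝ) (L2 : Matrix (Fin n) (Fin n) ℝ) :
    Matrix (Fin n) (Fin 1) ℝ :=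
  (1 / (N : ℝ)) • (Θᵀ * p.B0ᵀ * L2 * (p.D0 - p.B0 * Θ₂) + L2 * p.B * Θ₂)

/-- ǧ₀₂. -/
noncomputable def gc02 (N : ℕ) (Θ₁ : Matrix (Fin n₁) (Fin n) ℝ)
    (Θ₂ : Matrix (Fin n₁) (Fin 1) ℝ) (L2 : Matrix (Fin n) (Fin n) ℝ) :
    Matrix (Fin n) (Fin 1) ℝ :=
  (1 / (N : ℝ)) • (-(Θ₁ᵀ * p.B0ᵀ * L2 * p.B0 * Θ₂) + Θ₁ᵀ * p.B0ᵀ * L2 * p.D0)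

/-- RHS of (ODE-Λ̌₁^N) (paper's −dΛ̌₁^N/dt). -/
noncomputable def check1RHS (N : ℕ) (Θ : Matrix (Fin n₁) (Fin n) ℝ)
    (L1 L2 : Matrix (Fin n) (Fin n) ℝ) : Matrix (Fin n) (Fin n) ℝ :=
  Θᵀ * p.R1 L1 * Θ + L1 * (p.A - p.B * Θ) + (p.A - p.B * Θ)ᵀ * L1 + p.Q
    + p.gc1 N Θ L1 L2

/-- RHS of (ODE-Λ̌₂^N). -/
noncomputable def check2RHS (N : ℕ) (Θ : Matrix (Fin n₁) (Fin n) ℝ)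
    (L1 L2 : Matrix (Fin n) (Fin n) ℝ) : Matrix (Fin n) (Fin n) ℝ :=
  Θᵀ * p.B0ᵀ * (L1 + L2) * p.B0 * Θ + L1 * p.G + p.Gᵀ * L1
    + L2 * (p.A + p.G - p.B * Θ) + (p.A + p.G - p.B * Θ)ᵀ * L2 + p.QΓ
    + p.gc2 N Θ L2

/-- RHS of (ODE-Λ̌₁₂^N). -/
noncomputable def check12RHS (N : ℕ) (Θ Θ₁ : Matrix (Fin n₁) (Fin n) ℝ)
    (L1 L2 L12 : Matrix (Fin n) (Fin n) ℝ) : Matrix (Fin n) (Fin n) ℝ :=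
  Θᵀ * p.R2 L1 L2 * Θ₁ + Θᵀ * p.B0ᵀ * L12 * p.B0 * (Θ + Θ₁)
    - (L1 + L2) * p.B * Θ₁
    + (p.A + p.G - p.B * Θ)ᵀ * L12
    + L12 * (p.A + p.G - p.B * (Θ₁ + Θ))
    + p.gc12 N Θ Θ₁ L2

/-- RHS of (ODE-Λ̌₂₂^N). -/
noncomputable def check22RHS (N : ℕ) (Θ₁ : Matrix (Fin n₁) (Fin n) ℝ)
    (Z₀ Z₁ : Matrix (Fin n) (Fin n) ℝ)
    (L1 L2 L12 L22 : Matrix (Fin n) (Fin n) ℝ) : Matrix (Fin n) (Fin n) ℝ :=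
  Θ₁ᵀ * p.R2 L1 L2 * Θ₁ - L12ᵀ * p.B * Θ₁ - Θ₁ᵀ * p.Bᵀ * L12
    + L22 * Z₁ + Z₁ᵀ * L22
    - Z₀ᵀ * L12ᵀ * p.B0 * Θ₁ - Θ₁ᵀ * p.B0ᵀ * L12 * Z₀
    + Z₀ᵀ * L22 * Z₀ + p.gc22 N Θ₁ L2

/-- RHS of (ODE-Š₁^N). -/
noncomputable def checkS1RHS (N : ℕ) (Θ : Matrix (Fin n₁) (Fin n) ℝ)
    (Θ₂ : Matrix (Fin n₁) (Fin 1) ℝ) (L1 L2 L12 : Matrix (Fin n) (Fin n) ℝ)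
    (S1 : Matrix (Fin n) (Fin 1) ℝ) : Matrix (Fin n) (Fin 1) ℝ :=
  Θᵀ * p.R2 L1 L2 * Θ₂ - (L1 + L2 + L12) * p.B * Θ₂
    - Θᵀ * (p.Bᵀ * S1 + p.B1ᵀ * L1 * p.D + p.B0ᵀ * (L1 + L2) * p.D0)
    - Θᵀ * p.B0ᵀ * L12 * (p.D0 - p.B0 * Θ₂)
    + (p.A + p.G)ᵀ * S1
    + p.gc01 N Θ Θ₂ L2

/-- RHS of (ODE-Š₂^N). -/
noncomputable def checkS2RHS (N : ℕ) (Θ₁ : Matrix (Fin n₁) (Fin n) ℝ)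
    (Θ₂ : Matrix (Fin n₁) (Fin 1) ℝ) (Z₀ Z₁ : Matrix (Fin n) (Fin n) ℝ)
    (L1 L2 L12 L22 : Matrix (Fin n) (Fin n) ℝ)
    (S1 S2 : Matrix (Fin n) (Fin 1) ℝ) : Matrix (Fin n) (Fin 1) ℝ :=
  Θ₁ᵀ * p.R2 L1 L2 * Θ₂ + Z₁ᵀ * S2
    - Θ₁ᵀ * (p.Bᵀ * S1 + p.B1ᵀ * L1 * p.D + p.B0ᵀ * (L1 + L2) * p.D0)
    + (Z₀ᵀ * L22 + Z₀ᵀ * L12ᵀ - Θ₁ᵀ * p.B0ᵀ * L12) * (p.D0 - p.B0 * Θ₂)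
    - (L12ᵀ + L22) * p.B * Θ₂
    + p.gc02 N Θ₁ Θ₂ L2

/-- Solution of the pair (ODE-Λ̌₁^N)–(ODE-Λ̌₂^N) on [0,T], with Θ(t) from the limiting Λ₁. -/
noncomputable def IsSolCheckA (N : ℕ) (Λ₁ : ℝ → Matrix (Fin n) (Fin n) ℝ)
    (L1 L2 : ℝ → Matrix (Fin n) (Fin n) ℝ) : Prop :=
  L1 p.T = p.Qf + (1 / (N : ℝ)) • p.QfΓ ∧ L2 p.T = p.QfΓ ∧
  (∀ t ∈ Icc (0 : ℝ) p.T, ∀ i j, HasDerivWithinAt (fun s => L1 s i j)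
    ((-(p.check1RHS N (p.Theta (Λ₁ t)) (L1 t) (L2 t))) i j) (Icc (0 : ℝ) p.T) t) ∧
  (∀ t ∈ Icc (0 : ℝ) p.T, ∀ i j, HasDerivWithinAt (fun s => L2 s i j)
    ((-(p.check2RHS N (p.Theta (Λ₁ t)) (L1 t) (L2 t))) i j) (Icc (0 : ℝ) p.T) t)

/-- Solution of (ODE-Λ̌₁^N)–(ODE-Λ̌₂₂^N) on [0,T], with Θ, Θ₁, Z₀, Z₁ from the limiting (Λ₁, Λ₂). -/
noncomputable def IsSolCheckB (N : ℕ) (Λ₁ Λ₂ : ℝ → Matrix (Fin n) (Fin n) ℝ)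
    (L1 L2 L12 L22 : ℝ → Matrix (Fin n) (Fin n) ℝ) : Prop :=
  p.IsSolCheckA N Λ₁ L1 L2 ∧
  L12 p.T = 0 ∧ L22 p.T = 0 ∧
  (∀ t ∈ Icc (0 : ℝ) p.T, ∀ i j, HasDerivWithinAt (fun s => L12 s i j)
    ((-(p.check12RHS N (p.Theta (Λ₁ t)) (p.Theta1 (Λ₁ t) (Λ₂ t))
        (L1 t) (L2 t) (L12 t))) i j) (Icc (0 : ℝ) p.T) t) ∧
  (∀ t ∈ Icc (0 : ℝ) p.T, ∀ i j, HasDerivWithinAt (fun s => L22 s i j)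
    ((-(p.check22RHS N (p.Theta1 (Λ₁ t) (Λ₂ t)) (p.Z0 (Λ₁ t) (Λ₂ t))
        (p.Z1 (Λ₁ t) (Λ₂ t)) (L1 t) (L2 t) (L12 t) (L22 t))) i j) (Icc (0 : ℝ) p.T) t)

/-- Solution of the full decentralized coefficient system on [0,T],
with Θ, Θ₁, Θ₂, Z₀, Z₁ from the limiting (Λ₁, Λ₂, S). -/
noncomputable def IsSolCheckC (N : ℕ) (Λ₁ Λ₂ : ℝ → Matrix (Fin n) (Fin n) ℝ)
    (S : ℝ → Matrix (Fin n) (Fin 1) ℝ)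
    (L1 L2 L12 L22 : ℝ → Matrix (Fin n) (Fin n) ℝ)
    (S1 S2 : ℝ → Matrix (Fin n) (Fin 1) ℝ) : Prop :=
  p.IsSolCheckB N Λ₁ Λ₂ L1 L2 L12 L22 ∧
  S1 p.T = 0 ∧ S2 p.T = 0 ∧
  (∀ t ∈ Icc (0 : ℝ) p.T, ∀ i j, HasDerivWithinAt (fun s => S1 s i j)
    ((-(p.checkS1RHS N (p.Theta (Λ₁ t)) (p.Theta2 (Λ₁ t) (Λ₂ t) (S t))
        (L1 t) (L2 t) (L12 t) (S1 t))) i j) (Icc (0 : ℝ) p.T) t) ∧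
  (∀ t ∈ Icc (0 : ℝ) p.T, ∀ i j, HasDerivWithinAt (fun s => S2 s i j)
    ((-(p.checkS2RHS N (p.Theta1 (Λ₁ t) (Λ₂ t)) (p.Theta2 (Λ₁ t) (Λ₂ t) (S t))
        (p.Z0 (Λ₁ t) (Λ₂ t)) (p.Z1 (Λ₁ t) (Λ₂ t))
        (L1 t) (L2 t) (L12 t) (L22 t) (S1 t) (S2 t))) i j) (Icc (0 : ℝ) p.T) t)

end Params

/-! Perturbation of ordinary differential equations depending on a small parameter. -/

section Perturbation

variable {E F : Type*} [NormedAddCommGroup E] [NormedSpace ℝ E]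
  [NormedAddCommGroup F] [NormedSpace ℝ F]

/-- A map that is `C¹` along the curve `{0} × x(I)`, with `I` compact, is uniformly Lipschitz
near that curve. -/
theorem exists_uniform_lipschitz_near_curve {K : ℝ × E → F} {x : ℝ → E} {I : Set ℝ}
    (hI : IsCompact I) (hx : ContinuousOn x I)
    (hK : ∀ t ∈ I, ContDiffAt ℝ 1 K (0, x t)) :
    ∃ δ > 0, ∃ L ≥ 0, ∀ t ∈ I, ∀ ε y, |ε| ≤ δ → ‖y - x t‖ ≤ δ →
      ‖K (ε, y) - K (0, x t)‖ ≤ L * (|ε| + ‖y - x t‖) := by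
  refine hI.induction_on (p := fun J => ∃ δ > 0, ∃ L ≥ 0, ∀ t ∈ J, ∀ ε y, |ε| ≤ δ →
      ‖y - x t‖ ≤ δ → ‖K (ε, y) - K (0, x t)‖ ≤ L * (|ε| + ‖y - x t‖)) ?_ ?_ ?_ ?_
  · exact ⟨1, one_pos, 0, le_rfl, by simp⟩
  · rintro s t hst ⟨δ, hδ, L, hL, h⟩
    exact ⟨δ, hδ, L, hL, fun u hu => h u (hst hu)⟩
  · rintro s t ⟨δ, hδ, L, hL, h⟩ ⟨δ', hδ', L', hL', h'⟩
    refine ⟨min δ δ', lt_min hδ hδ', max L L', le_max_of_le_left hL, ?_⟩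
    rintro u (hu | hu) ε y hε hy
    · refine (h u hu ε y (hε.trans (min_le_left _ _)) (hy.trans (min_le_left _ _))).trans ?_
      gcongr
      exact le_max_left _ _
    · refine (h' u hu ε y (hε.trans (min_le_right _ _)) (hy.trans (min_le_right _ _))).trans ?_
      gcongr
      exact le_max_right _ _
  · intro t ht
    obtain ⟨L, V, hV, hL⟩ := (hK t ht).exists_lipschitzOnWith
    obtain ⟨ρ, hρ, hball⟩ := Metric.mem_nhds_iff.1 hV
    refine ⟨{u | dist (x u) (x t) < ρ / 2},
      (hx t ht) (Metric.ball_mem_nhds _ (half_pos hρ)), ρ / 4, by positivity, L, L.2, ?_⟩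
    intro u hu ε y hε hy
    have hu' : dist (x u) (x t) < ρ / 2 := hu
    have h₀ : ((0 : ℝ), x u) ∈ V := hball (by
      rw [Metric.mem_ball, Prod.dist_eq]
      exact max_lt (by simpa using hρ) (by simp only; linarith))
    have h₁ : (ε, y) ∈ V := hball (by
      rw [Metric.mem_ball, Prod.dist_eq]
      refine max_lt ?_ ?_
      · simp only [dist_zero_right, Real.norm_eq_abs]; linarith
      · have := dist_triangle y (x u) (x t)
        rw [dist_eq_norm y (x u)] at this
        simp only
        linarith)
    have h := hL.dist_le_mul _ h₁ _ h₀
    rw [dist_eq_norm] at h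
    refine h.trans ?_
    gcongr
    rw [Prod.dist_eq, dist_eq_norm y]
    simp only [dist_zero_right, Real.norm_eq_abs]
    exact max_le (by linarith [norm_nonneg (y - x u)]) (by linarith [abs_nonneg ε])

theorem continuousOn_of_hasDerivWithinAt {x x' : ℝ → E} {I : Set ℝ}
    (hx : ∀ t ∈ I, HasDerivWithinAt x (x' t) I t) : ContinuousOn x I :=
  fun t ht => (hx t ht).continuousWithinAt

/-- Solutions of the equation `dy/dt = F(ε, y)` on `[0, T]` whose terminal value is `O(ε)`-close
to that of a solution `x` of `dx/dt = F(0, x)` stay `O(ε)`-close to `x`. -/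
theorem exists_terminal_value_perturbation_bound {F : ℝ × E → E} {x : ℝ → E} {T : ℝ}
    (hx : ∀ t ∈ Icc 0 T, HasDerivWithinAt x (F (0, x t)) (Icc 0 T) t)
    (hF : ∀ t ∈ Icc 0 T, ContDiffAt ℝ 1 F (0, x t)) (M : ℝ) :
    ∃ ε₀ > 0, ∃ C ≥ 0, ∀ ε, 0 < ε → ε ≤ ε₀ → ∀ y : ℝ → E,
      (∀ t ∈ Icc 0 T, HasDerivWithinAt y (F (ε, y t)) (Icc 0 T) t) →
      ‖y T - x T‖ ≤ M * ε → ∀ t ∈ Icc 0 T, ‖y t - x t‖ ≤ C * ε := by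
  obtain ⟨δ, hδ, L, hL, hLip⟩ := exists_uniform_lipschitz_near_curve isCompact_Icc
    (continuousOn_of_hasDerivWithinAt hx) hF
  set M₁ := max 1 M
  have hM₁ : 1 ≤ M₁ := le_max_left _ _
  set a := 2 * L + 1 with ha
  have ha0 : 0 < a := by positivity
  set C := M₁ * Real.exp (a * T) with hC
  have hC0 : 0 < C := by positivity
  refine ⟨min δ (δ / C), by positivity, C, hC0.le, ?_⟩
  intro ε hε hεle y hy hT t ht
  have hεδ : |ε| ≤ δ := by rw [abs_of_pos hε]; exact hεle.trans (min_le_left _ _)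
  have hCε : C * ε ≤ δ := by
    have := hεle.trans (min_le_right _ _)
    rwa [le_div_iff₀ hC0, mul_comm] at this
  set u : ℝ → E := fun s => y (T - s) - x (T - s) with hu
  have hmaps : MapsTo (fun s : ℝ => T - s) (Icc 0 T) (Icc 0 T) := fun s hs =>
    ⟨by linarith [hs.2], by linarith [hs.1]⟩
  have hderiv : ∀ s ∈ Icc 0 T, HasDerivWithinAt u
      (-(F (ε, y (T - s)) - F (0, x (T - s)))) (Icc 0 T) s := by
    intro s hs
    have h := ((hy _ (hmaps hs)).sub (hx _ (hmaps hs))).scomp s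
      ((hasDerivWithinAt_id s (Icc 0 T)).const_sub T) hmaps
    simpa [hu, Function.comp_def] using h
  have hB : ∀ s : ℝ, HasDerivAt (fun s => M₁ * ε * Real.exp (a * s))
      (a * (M₁ * ε * Real.exp (a * s))) s := by
    intro s
    have h := (((hasDerivAt_id s).const_mul a).exp).const_mul (M₁ * ε)
    simpa [mul_comm, mul_left_comm, mul_assoc] using h
  have key := image_norm_le_of_norm_deriv_right_lt_deriv_boundary (a := 0) (b := T)
    (continuousOn_of_hasDerivWithinAt hderiv)
    (fun s hs => (hderiv s ⟨hs.1, hs.2.le⟩).mono_of_mem_nhdsWithin (Icc_mem_nhdsGE_of_mem hs))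
    (B := fun s => M₁ * ε * Real.exp (a * s)) ?_ hB ?_ (hmaps ht)
  · simp only [hu, sub_sub_cancel] at key
    refine key.trans ?_
    calc M₁ * ε * Real.exp (a * (T - t)) ≤ M₁ * ε * Real.exp (a * T) := by
          gcongr
          linarith [ht.1]
      _ = C * ε := by rw [hC]; ring
  · simp only [hu, sub_zero, mul_zero, Real.exp_zero, mul_one]
    refine hT.trans ?_
    gcongr
    exact le_max_right _ _
  · intro s hs hsB
    have hs' := hmaps ⟨hs.1, hs.2.le⟩
    set b := M₁ * ε * Real.exp (a * s) with hb
    have hεb : ε ≤ b := by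
      have h1 : 1 ≤ Real.exp (a * s) := Real.one_le_exp (by have := hs.1; positivity)
      calc ε = 1 * ε * 1 := by ring
        _ ≤ b := by rw [hb]; gcongr
    have hbδ : b ≤ δ := by
      refine le_trans ?_ hCε
      calc b ≤ M₁ * ε * Real.exp (a * T) := by
            rw [hb]
            gcongr
            exact hs.2.le
        _ = C * ε := by rw [hC]; ring
    have hub : ‖y (T - s) - x (T - s)‖ = b := hsB
    have h := hLip _ hs' ε _ hεδ (hub.le.trans hbδ)
    rw [hub, abs_of_pos hε] at h
    rw [norm_neg]
    refine h.trans_lt ?_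
    calc L * (ε + b) ≤ L * (b + b) := by gcongr
      _ < a * b := by rw [ha]; linarith

end Perturbation

/-! Matrix-valued maps with continuously differentiable entries. -/

/-- All entries of the matrix-valued map `M` are `C¹` at `z`. -/
@[fun_prop]
def EntrywiseC1At {X : Type*} [NormedAddCommGroup X] [NormedSpace ℝ X] {a b : Type*}
    (M : X → Matrix a b ℝ) (z : X) : Prop :=
  ∀ i j, ContDiffAt ℝ 1 (fun w => M w i j) z

namespace EntrywiseC1At

variable {X : Type*} [NormedAddCommGroup X] [NormedSpace ℝ X] {a b c : Type*} {z : X}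

@[fun_prop]
theorem const (M : Matrix a b ℝ) : EntrywiseC1At (fun _ : X => M) z :=
  fun _ _ => contDiffAt_const

@[fun_prop]
theorem add {M K : X → Matrix a b ℝ} (hM : EntrywiseC1At M z) (hK : EntrywiseC1At K z) :
    EntrywiseC1At (fun w => M w + K w) z :=
  fun i j => (hM i j).add (hK i j)

@[fun_prop]
theorem sub {M K : X → Matrix a b ℝ} (hM : EntrywiseC1At M z) (hK : EntrywiseC1At K z) :
    EntrywiseC1At (fun w => M w - K w) z :=
  fun i j => (hM i j).sub (hK i j)

@[fun_prop]
theorem smul {f : X → ℝ} {M : X → Matrix a b ℝ} (hf : ContDiffAt ℝ 1 f z)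
    (hM : EntrywiseC1At M z) : EntrywiseC1At (fun w => f w • M w) z :=
  fun i j => hf.mul (hM i j)

@[fun_prop]
theorem mul [Fintype b] {M : X → Matrix a b ℝ} {K : X → Matrix b c ℝ}
    (hM : EntrywiseC1At M z) (hK : EntrywiseC1At K z) :
    EntrywiseC1At (fun w => M w * K w) z := by
  intro i j
  simp only [Matrix.mul_apply]
  exact ContDiffAt.sum fun k _ => (hM i k).mul (hK k j)

theorem det [Fintype a] [DecidableEq a] {M : X → Matrix a a ℝ} (hM : EntrywiseC1At M z) :
    ContDiffAt ℝ 1 (fun w => (M w).det) z := by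
  simp only [Matrix.det_apply']
  exact ContDiffAt.sum fun σ _ => contDiffAt_const.mul (contDiffAt_prod fun k _ => hM _ k)

theorem inv [Fintype a] [DecidableEq a] {M : X → Matrix a a ℝ} (hM : EntrywiseC1At M z)
    (hz : (M z).det ≠ 0) : EntrywiseC1At (fun w => (M w)⁻¹) z := by
  intro i j
  simp only [Matrix.inv_def, Matrix.smul_apply, Ring.inverse_eq_inv', smul_eq_mul,
    Matrix.adjugate_apply]
  refine (hM.det.inv hz).mul (det fun k l => ?_)
  by_cases h : k = j
  · subst h
    simpa using contDiffAt_const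
  · simpa [Matrix.updateRow_ne h] using hM k l

end EntrywiseC1At

theorem frob_le_of_forall_abs_le {a b : Type*} [Fintype a] [Fintype b] {M : Matrix a b ℝ} {c : ℝ}
    (hc : 0 ≤ c) (h : ∀ i j, |M i j| ≤ c) :
    frob M ≤ Real.sqrt (Fintype.card a * Fintype.card b) * c := by
  have hsum : ∑ i, ∑ j, (M i j) ^ 2 ≤ (Fintype.card a * Fintype.card b : ℝ) * c ^ 2 := by
    calc ∑ i, ∑ j, (M i j) ^ 2 ≤ ∑ _i : a, ∑ _j : b, c ^ 2 :=
          Finset.sum_le_sum fun i _ => Finset.sum_le_sum fun j _ =>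
            sq_le_sq.2 ((h i j).trans (le_abs_self c))
      _ = (Fintype.card a * Fintype.card b : ℝ) * c ^ 2 := by simp [mul_assoc]
  calc frob M ≤ Real.sqrt ((Fintype.card a * Fintype.card b : ℝ) * c ^ 2) :=
        Real.sqrt_le_sqrt hsum
    _ = Real.sqrt (Fintype.card a * Fintype.card b) * c := by
        rw [Real.sqrt_mul (by positivity), Real.sqrt_sq hc]

namespace Params

/-! The rescaled systems with `1 / N` replaced by a real parameter `ε`. -/

variable {n n₁ : ℕ} (p : Params n n₁)

/-- `[ℛ₂ − ε B₀ᵀ Λ₂ B₀]⁻¹`. -/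
noncomputable def epsR2Inv (ε : ℝ) (Λ₁ Λ₂ : Matrix (Fin n) (Fin n) ℝ) :
    Matrix (Fin n₁) (Fin n₁) ℝ :=
  (p.R2 Λ₁ Λ₂ - ε • (p.B0ᵀ * Λ₂ * p.B0))⁻¹

/-- The matrix `E^N / ε`. -/
noncomputable def epsEQuot (ε : ℝ) (Λ₁ Λ₂ : Matrix (Fin n) (Fin n) ℝ) :
    Matrix (Fin n₁) (Fin n₁) ℝ :=
  p.epsR2Inv ε Λ₁ Λ₂ - (p.R1 Λ₁)⁻¹

/-- `E^N` as a function of `ε`. -/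
noncomputable def epsE (ε : ℝ) (Λ₁ Λ₂ : Matrix (Fin n) (Fin n) ℝ) :
    Matrix (Fin n₁) (Fin n₁) ℝ :=
  ε • p.epsEQuot ε Λ₁ Λ₂

/-- `H^N + (N − 2) E^N` as a function of `ε`. -/
noncomputable def epsHE (ε : ℝ) (Λ₁ Λ₂ : Matrix (Fin n) (Fin n) ℝ) :
    Matrix (Fin n₁) (Fin n₁) ℝ :=
  p.epsE ε Λ₁ Λ₂ + (p.R1 Λ₁)⁻¹ + (1 - 2 * ε) • p.epsEQuot ε Λ₁ Λ₂

/-- Right-hand side of the `Λ₁` equation as a function of `ε`. -/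
noncomputable def epsRhs₁ (ε : ℝ) (Λ₁ Λ₂ : Matrix (Fin n) (Fin n) ℝ) :
    Matrix (Fin n) (Fin n) ℝ :=
  p.Ψ₁ Λ₁ +
  (Λ₁ * p.B * p.epsE ε Λ₁ Λ₂ * p.Bᵀ * Λ₁
  + (1 - ε) •
      (Λ₂ * p.B * p.epsE ε Λ₁ Λ₂ * p.Bᵀ * Λ₁ + Λ₁ * p.B * p.epsE ε Λ₁ Λ₂ * p.Bᵀ * Λ₂)
  + (ε - ε ^ 2) • (Λ₂ * p.B * p.epsHE ε Λ₁ Λ₂ * p.Bᵀ * Λ₂)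
  - ε • ((Λ₁ * p.G + p.Gᵀ * Λ₁) + (1 - ε) • (Λ₂ * p.G + p.Gᵀ * Λ₂))
  - ε • p.QΓ)

/-- Right-hand side of the `Λ₂` equation as a function of `ε`. -/
noncomputable def epsRhs₂ (ε : ℝ) (Λ₁ Λ₂ : Matrix (Fin n) (Fin n) ℝ) :
    Matrix (Fin n) (Fin n) ℝ :=
  p.Ψ₂ Λ₁ Λ₂ +
  ((Λ₁ + Λ₂) * p.B *
      (p.epsEQuot ε Λ₁ Λ₂ + (p.R1 Λ₁)⁻¹ - (p.R2 Λ₁ Λ₂)⁻¹) * p.Bᵀ * (Λ₁ + Λ₂)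
  - (2 * ε) • (Λ₂ * p.B * (p.R1 Λ₁)⁻¹ * p.Bᵀ * Λ₂)
  + (ε - 2) • (Λ₂ * p.B * p.epsE ε Λ₁ Λ₂ * p.Bᵀ * Λ₂)
  - Λ₁ * p.B * p.epsE ε Λ₁ Λ₂ * p.Bᵀ * Λ₂
  - Λ₂ * p.B * p.epsE ε Λ₁ Λ₂ * p.Bᵀ * Λ₁
  + ε • (Λ₂ * p.G + p.Gᵀ * Λ₂))

/-- Right-hand side of the `S` equation as a function of `ε`. -/
noncomputable def epsRhsS (ε : ℝ) (Λ₁ Λ₂ : Matrix (Fin n) (Fin n) ℝ)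
    (S : Matrix (Fin n) (Fin 1) ℝ) : Matrix (Fin n) (Fin 1) ℝ :=
  (Λ₁ + (1 - ε) • Λ₂) * p.B * p.epsR2Inv ε Λ₁ Λ₂ *
      (p.Bᵀ * S + p.B1ᵀ * Λ₁ * p.D + p.B0ᵀ * (Λ₁ + (1 - ε) • Λ₂) * p.D0)
    - (p.A + p.G)ᵀ * S

/-- `Θ^N` as a function of `ε`. -/
noncomputable def epsTheta (ε : ℝ) (Λ₁ Λ₂ : Matrix (Fin n) (Fin n) ℝ) :
    Matrix (Fin n₁) (Fin n) ℝ :=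
  (p.R1 Λ₁)⁻¹ * p.Bᵀ * (Λ₁ - ε • Λ₂)

/-- `Θ₁^N` as a function of `ε`. -/
noncomputable def epsTheta1 (ε : ℝ) (Λ₁ Λ₂ : Matrix (Fin n) (Fin n) ℝ) :
    Matrix (Fin n₁) (Fin n) ℝ :=
  p.epsEQuot ε Λ₁ Λ₂ * p.Bᵀ * Λ₁ + p.epsHE ε Λ₁ Λ₂ * p.Bᵀ * Λ₂

/-- `Θ₂^N` as a function of `ε`. -/
noncomputable def epsTheta2 (ε : ℝ) (Λ₁ Λ₂ : Matrix (Fin n) (Fin n) ℝ)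
    (S : Matrix (Fin n) (Fin 1) ℝ) : Matrix (Fin n₁) (Fin 1) ℝ :=
  p.epsR2Inv ε Λ₁ Λ₂ *
    (p.Bᵀ * S + p.B1ᵀ * Λ₁ * p.D + p.B0ᵀ * (Λ₁ + (1 - ε) • Λ₂) * p.D0)

section Specialization

variable (Λ₁ Λ₂ : Matrix (Fin n) (Fin n) ℝ) (S : Matrix (Fin n) (Fin 1) ℝ)

theorem epsR2Inv_zero : p.epsR2Inv 0 Λ₁ Λ₂ = (p.R2 Λ₁ Λ₂)⁻¹ := by
  simp [epsR2Inv]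

theorem epsE_zero : p.epsE 0 Λ₁ Λ₂ = 0 := by
  simp [epsE]

theorem epsHE_zero : p.epsHE 0 Λ₁ Λ₂ = (p.R2 Λ₁ Λ₂)⁻¹ := by
  simp [epsHE, epsE_zero, epsEQuot, epsR2Inv_zero]

theorem epsRhs₁_zero : p.epsRhs₁ 0 Λ₁ Λ₂ = p.Ψ₁ Λ₁ := by
  simp [epsRhs₁, epsE_zero]

theorem epsRhs₂_zero : p.epsRhs₂ 0 Λ₁ Λ₂ = p.Ψ₂ Λ₁ Λ₂ := by
  simp [epsRhs₂, epsE_zero, epsEQuot, epsR2Inv_zero]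

theorem epsRhsS_zero : p.epsRhsS 0 Λ₁ Λ₂ S = p.φ₁ Λ₁ Λ₂ S := by
  simp [epsRhsS, φ₁, epsR2Inv_zero]

theorem epsTheta_zero : p.epsTheta 0 Λ₁ Λ₂ = p.Theta Λ₁ := by
  simp [epsTheta, Theta]

theorem epsTheta1_zero : p.epsTheta1 0 Λ₁ Λ₂ = p.Theta1 Λ₁ Λ₂ := by
  simp only [epsTheta1, Theta1, epsHE_zero, epsEQuot, epsR2Inv_zero, Matrix.sub_mul,
    Matrix.mul_add]
  abel

theorem epsTheta2_zero : p.epsTheta2 0 Λ₁ Λ₂ S = p.Theta2 Λ₁ Λ₂ S := by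
  simp [epsTheta2, Theta2, epsR2Inv_zero]

variable {N : ℕ}

theorem epsE_one_div : p.epsE (1 / (N : ℝ)) Λ₁ Λ₂ = p.EN N Λ₁ Λ₂ := rfl

theorem natCast_smul_EN
    (hN : N ≠ 0) : (N : ℝ) • p.EN N Λ₁ Λ₂ = p.epsEQuot (1 / (N : ℝ)) Λ₁ Λ₂ := by
  have : (N : ℝ) ≠ 0 := Nat.cast_ne_zero.2 hN
  rw [← epsE_one_div, epsE, smul_smul, mul_one_div_cancel this, one_smul]

theorem epsHE_one_div
    (hN : N ≠ 0) : p.epsHE (1 / (N : ℝ)) Λ₁ Λ₂ =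
    p.HN N Λ₁ Λ₂ + ((N : ℝ) - 2) • p.EN N Λ₁ Λ₂ := by
  rw [epsHE, epsE_one_div, HN, ← p.natCast_smul_EN Λ₁ Λ₂ hN, smul_smul]
  have : (N : ℝ) ≠ 0 := Nat.cast_ne_zero.2 hN
  congr 2
  field_simp

theorem epsRhs₁_one_div
    (hN : N ≠ 0) : p.epsRhs₁ (1 / (N : ℝ)) Λ₁ Λ₂ = p.Ψ₁ Λ₁ + p.g₁ N Λ₁ Λ₂ := by
  rw [epsRhs₁, g₁, epsHE_one_div _ _ _ hN, epsE_one_div, _root_.one_div_pow]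

theorem epsRhs₂_one_div
    (hN : N ≠ 0) : p.epsRhs₂ (1 / (N : ℝ)) Λ₁ Λ₂ = p.Ψ₂ Λ₁ Λ₂ + p.g₂ N Λ₁ Λ₂ := by
  rw [epsRhs₂, g₂, natCast_smul_EN _ _ _ hN, epsE_one_div, mul_one_div]

theorem epsRhsS_one_div :
    p.epsRhsS (1 / (N : ℝ)) Λ₁ Λ₂ S = p.φ₁ Λ₁ Λ₂ S + p.g01 N Λ₁ Λ₂ S := by
  rw [epsRhsS, epsR2Inv, φ₁, g01]
  abel

theorem epsTheta_one_div : p.epsTheta (1 / (N : ℝ)) Λ₁ Λ₂ = p.ThetaN N Λ₁ Λ₂ := by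
  simp [epsTheta, ThetaN, HN]

theorem epsTheta1_one_div
    (hN : N ≠ 0) :
    p.epsTheta1 (1 / (N : ℝ)) Λ₁ Λ₂ = p.Theta1N N Λ₁ Λ₂ := by
  rw [epsTheta1, Theta1N, epsHE_one_div _ _ _ hN, ← natCast_smul_EN _ _ _ hN,
    Matrix.smul_mul, Matrix.smul_mul]

theorem epsTheta2_one_div
    (hN : N ≠ 0) :
    p.epsTheta2 (1 / (N : ℝ)) Λ₁ Λ₂ S = p.Theta2N N Λ₁ Λ₂ S := by
  have h : p.HN N Λ₁ Λ₂ + ((N : ℝ) - 1) • p.EN N Λ₁ Λ₂ = p.epsR2Inv (1 / (N : ℝ)) Λ₁ Λ₂ := by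
    rw [sub_smul, natCast_smul_EN _ _ _ hN, HN, epsEQuot, one_smul]
    abel
  rw [epsTheta2, Theta2N, h]

end Specialization

/-! The combined system for `(Λ₁, Λ₂, S)` on a normed space. -/

/-- The triples `(Λ₁, Λ₂, S)`, with the sup norm. -/
abbrev State (n : ℕ) : Type :=
  (Fin n → Fin n → ℝ) × (Fin n → Fin n → ℝ) × (Fin n → Fin 1 → ℝ)

/-- Right-hand side of the combined system. -/
noncomputable def stateField (w : ℝ × State n) : State n :=
  (of.symm (p.epsRhs₁ w.1 (of w.2.1) (of w.2.2.1)),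
    of.symm (p.epsRhs₂ w.1 (of w.2.1) (of w.2.2.1)),
    of.symm (p.epsRhsS w.1 (of w.2.1) (of w.2.2.1) (of w.2.2.2)))

/-- The triple of feedback gains. -/
noncomputable def stateGains (w : ℝ × State n) :
    (Fin n₁ → Fin n → ℝ) × (Fin n₁ → Fin n → ℝ) × (Fin n₁ → Fin 1 → ℝ) :=
  (of.symm (p.epsTheta w.1 (of w.2.1) (of w.2.2.1)),
    of.symm (p.epsTheta1 w.1 (of w.2.1) (of w.2.2.1)),
    of.symm (p.epsTheta2 w.1 (of w.2.1) (of w.2.2.1) (of w.2.2.2)))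

/-- A curve of triples of matrices, as a curve in `State n`. -/
def stateCurve (Λ₁ Λ₂ : ℝ → Matrix (Fin n) (Fin n) ℝ) (S : ℝ → Matrix (Fin n) (Fin 1) ℝ)
    (t : ℝ) : State n :=
  (of.symm (Λ₁ t), of.symm (Λ₂ t), of.symm (S t))

theorem hasDerivWithinAt_stateCurve {Λ₁ Λ₂ : ℝ → Matrix (Fin n) (Fin n) ℝ}
    {S : ℝ → Matrix (Fin n) (Fin 1) ℝ} {M₁ M₂ : Matrix (Fin n) (Fin n) ℝ}
    {M₃ : Matrix (Fin n) (Fin 1) ℝ} {I : Set ℝ} {t : ℝ}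
    (h₁ : ∀ i j, HasDerivWithinAt (fun s => Λ₁ s i j) (M₁ i j) I t)
    (h₂ : ∀ i j, HasDerivWithinAt (fun s => Λ₂ s i j) (M₂ i j) I t)
    (h₃ : ∀ i j, HasDerivWithinAt (fun s => S s i j) (M₃ i j) I t) :
    HasDerivWithinAt (stateCurve Λ₁ Λ₂ S) (of.symm M₁, of.symm M₂, of.symm M₃) I t := by
  refine HasDerivWithinAt.prodMk ?_ (HasDerivWithinAt.prodMk ?_ ?_)
  · exact hasDerivWithinAt_pi.2 fun i => hasDerivWithinAt_pi.2 fun j => h₁ i j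
  · exact hasDerivWithinAt_pi.2 fun i => hasDerivWithinAt_pi.2 fun j => h₂ i j
  · exact hasDerivWithinAt_pi.2 fun i => hasDerivWithinAt_pi.2 fun j => h₃ i j

section Smoothness

variable {z : ℝ × State n}

@[fun_prop]
theorem entrywiseC1At_fst :
    EntrywiseC1At (fun w : ℝ × State n => of w.2.1) z := by
  intro i j
  simp only [of_apply]
  fun_prop

@[fun_prop]
theorem entrywiseC1At_snd :
    EntrywiseC1At (fun w : ℝ × State n => of w.2.2.1) z := by
  intro i j
  simp only [of_apply]
  fun_prop

@[fun_prop]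
theorem entrywiseC1At_trd :
    EntrywiseC1At (fun w : ℝ × State n => of w.2.2.2) z := by
  intro i j
  simp only [of_apply]
  fun_prop

theorem entrywiseC1At_R1_inv
    (hR₁ : (p.R1 (of z.2.1)).PosDef) :
    EntrywiseC1At (fun w : ℝ × State n => (p.R1 (of w.2.1))⁻¹) z := by
  refine EntrywiseC1At.inv ?_ hR₁.det_pos.ne'
  simp only [R1]
  fun_prop

theorem entrywiseC1At_R2_inv
    (hR₂ : (p.R2 (of z.2.1) (of z.2.2.1)).PosDef) :
    EntrywiseC1At (fun w : ℝ × State n => (p.R2 (of w.2.1) (of w.2.2.1))⁻¹) z := by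
  refine EntrywiseC1At.inv ?_ hR₂.det_pos.ne'
  simp only [R2]
  fun_prop

theorem entrywiseC1At_epsR2Inv
    (hR₂ : (p.R2 (of z.2.1) (of z.2.2.1)).PosDef)
    (hz : z.1 = 0) :
    EntrywiseC1At (fun w : ℝ × State n => p.epsR2Inv w.1 (of w.2.1) (of w.2.2.1)) z := by
  simp only [epsR2Inv]
  refine EntrywiseC1At.inv ?_ ?_
  · simp only [R2]
    fun_prop
  · simpa [hz] using hR₂.det_pos.ne'

theorem entrywiseC1At_epsEQuot
    (hR₁ : (p.R1 (of z.2.1)).PosDef)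
    (hR₂ : (p.R2 (of z.2.1) (of z.2.2.1)).PosDef)
    (hz : z.1 = 0) :
    EntrywiseC1At (fun w : ℝ × State n => p.epsEQuot w.1 (of w.2.1) (of w.2.2.1)) z :=
  (p.entrywiseC1At_epsR2Inv hR₂ hz).sub (p.entrywiseC1At_R1_inv hR₁)

theorem entrywiseC1At_epsE
    (hR₁ : (p.R1 (of z.2.1)).PosDef)
    (hR₂ : (p.R2 (of z.2.1) (of z.2.2.1)).PosDef)
    (hz : z.1 = 0) :
    EntrywiseC1At (fun w : ℝ × State n => p.epsE w.1 (of w.2.1) (of w.2.2.1)) z :=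
  EntrywiseC1At.smul contDiffAt_fst (p.entrywiseC1At_epsEQuot hR₁ hR₂ hz)

theorem entrywiseC1At_epsHE
    (hR₁ : (p.R1 (of z.2.1)).PosDef)
    (hR₂ : (p.R2 (of z.2.1) (of z.2.2.1)).PosDef)
    (hz : z.1 = 0) :
    EntrywiseC1At (fun w : ℝ × State n => p.epsHE w.1 (of w.2.1) (of w.2.2.1)) z :=
  ((p.entrywiseC1At_epsE hR₁ hR₂ hz).add (p.entrywiseC1At_R1_inv hR₁)).add
    (EntrywiseC1At.smul (by fun_prop) (p.entrywiseC1At_epsEQuot hR₁ hR₂ hz))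

theorem contDiffAt_of_entrywiseC1At {a b : ℕ} {M : ℝ × State n → Matrix (Fin a) (Fin b) ℝ}
    (hM : EntrywiseC1At M z) : ContDiffAt ℝ 1 (fun w => of.symm (M w)) z :=
  contDiffAt_pi.2 fun i => contDiffAt_pi.2 fun j => hM i j

theorem contDiffAt_stateField
    (hR₁ : (p.R1 (of z.2.1)).PosDef)
    (hR₂ : (p.R2 (of z.2.1) (of z.2.2.1)).PosDef)
    (hz : z.1 = 0) : ContDiffAt ℝ 1 p.stateField z := by
  have hU := p.entrywiseC1At_R1_inv hR₁
  have hW := p.entrywiseC1At_R2_inv hR₂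
  have hWε := p.entrywiseC1At_epsR2Inv hR₂ hz
  have hV := p.entrywiseC1At_epsEQuot hR₁ hR₂ hz
  have hE := p.entrywiseC1At_epsE hR₁ hR₂ hz
  have hHE := p.entrywiseC1At_epsHE hR₁ hR₂ hz
  refine ContDiffAt.prodMk (contDiffAt_of_entrywiseC1At ?_)
    (ContDiffAt.prodMk (contDiffAt_of_entrywiseC1At ?_) (contDiffAt_of_entrywiseC1At ?_))
  · simp only [epsRhs₁, Ψ₁]
    fun_prop
  · simp only [epsRhs₂, Ψ₂]
    fun_prop
  · simp only [epsRhsS]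
    fun_prop

theorem contDiffAt_stateGains
    (hR₁ : (p.R1 (of z.2.1)).PosDef)
    (hR₂ : (p.R2 (of z.2.1) (of z.2.2.1)).PosDef)
    (hz : z.1 = 0) : ContDiffAt ℝ 1 p.stateGains z := by
  have hU := p.entrywiseC1At_R1_inv hR₁
  have hWε := p.entrywiseC1At_epsR2Inv hR₂ hz
  have hV := p.entrywiseC1At_epsEQuot hR₁ hR₂ hz
  have hHE := p.entrywiseC1At_epsHE hR₁ hR₂ hz
  refine ContDiffAt.prodMk (contDiffAt_of_entrywiseC1At ?_)
    (ContDiffAt.prodMk (contDiffAt_of_entrywiseC1At ?_) (contDiffAt_of_entrywiseC1At ?_))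
  · simp only [epsTheta]
    fun_prop
  · simp only [epsTheta1]
    fun_prop
  · simp only [epsTheta2]
    fun_prop

end Smoothness

theorem stateField_zero {Λ₁ Λ₂ : ℝ → Matrix (Fin n) (Fin n) ℝ}
    {S : ℝ → Matrix (Fin n) (Fin 1) ℝ} (t : ℝ) :
    p.stateField (0, stateCurve Λ₁ Λ₂ S t) =
      (of.symm (p.Ψ₁ (Λ₁ t)), of.symm (p.Ψ₂ (Λ₁ t) (Λ₂ t)),
        of.symm (p.φ₁ (Λ₁ t) (Λ₂ t) (S t))) := by
  simp only [stateField, stateCurve, Equiv.apply_symm_apply, epsRhs₁_zero, epsRhs₂_zero,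
    epsRhsS_zero]

theorem stateField_one_div {Λ₁ Λ₂ : ℝ → Matrix (Fin n) (Fin n) ℝ}
    {S : ℝ → Matrix (Fin n) (Fin 1) ℝ} {N : ℕ} (hN : N ≠ 0) (t : ℝ) :
    p.stateField (1 / (N : ℝ), stateCurve Λ₁ Λ₂ S t) =
      (of.symm (p.Ψ₁ (Λ₁ t) + p.g₁ N (Λ₁ t) (Λ₂ t)),
        of.symm (p.Ψ₂ (Λ₁ t) (Λ₂ t) + p.g₂ N (Λ₁ t) (Λ₂ t)),
        of.symm (p.φ₁ (Λ₁ t) (Λ₂ t) (S t) + p.g01 N (Λ₁ t) (Λ₂ t) (S t))) := by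
  simp only [stateField, stateCurve, Equiv.apply_symm_apply, epsRhs₁_one_div _ _ _ hN,
    epsRhs₂_one_div _ _ _ hN, epsRhsS_one_div]

theorem stateGains_zero {Λ₁ Λ₂ : ℝ → Matrix (Fin n) (Fin n) ℝ}
    {S : ℝ → Matrix (Fin n) (Fin 1) ℝ} (t : ℝ) :
    p.stateGains (0, stateCurve Λ₁ Λ₂ S t) =
      (of.symm (p.Theta (Λ₁ t)), of.symm (p.Theta1 (Λ₁ t) (Λ₂ t)),
        of.symm (p.Theta2 (Λ₁ t) (Λ₂ t) (S t))) := by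
  simp only [stateGains, stateCurve, Equiv.apply_symm_apply, epsTheta_zero, epsTheta1_zero,
    epsTheta2_zero]

theorem stateGains_one_div {Λ₁ Λ₂ : ℝ → Matrix (Fin n) (Fin n) ℝ}
    {S : ℝ → Matrix (Fin n) (Fin 1) ℝ} {N : ℕ} (hN : N ≠ 0) (t : ℝ) :
    p.stateGains (1 / (N : ℝ), stateCurve Λ₁ Λ₂ S t) =
      (of.symm (p.ThetaN N (Λ₁ t) (Λ₂ t)), of.symm (p.Theta1N N (Λ₁ t) (Λ₂ t)),
        of.symm (p.Theta2N N (Λ₁ t) (Λ₂ t) (S t))) := by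
  simp only [stateGains, stateCurve, Equiv.apply_symm_apply, epsTheta_one_div,
    epsTheta1_one_div _ _ _ hN, epsTheta2_one_div _ _ _ _ hN]

/-- The terminal values of the limiting and the rescaled systems differ by `O(1/N)`. -/
theorem norm_stateCurve_terminal_sub {Λ₁ Λ₂ Λ₁N Λ₂N : ℝ → Matrix (Fin n) (Fin n) ℝ}
    {S SN : ℝ → Matrix (Fin n) (Fin 1) ℝ} {r rN : ℝ → ℝ} {N : ℕ}
    (hLim : p.IsSolLim Λ₁ Λ₂) (hSr : p.IsSolSr Λ₁ Λ₂ S r)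
    (hLamN : p.IsSolLamN N Λ₁N Λ₂N) (hSrN : p.IsSolSrN N Λ₁N Λ₂N SN rN) :
    ‖stateCurve Λ₁N Λ₂N SN p.T - stateCurve Λ₁ Λ₂ S p.T‖ ≤
      ‖(of.symm p.QfΓ : Fin n → Fin n → ℝ)‖ * (1 / (N : ℝ)) := by
  obtain ⟨-, -, h₁, h₂, -, -⟩ := hLim
  obtain ⟨-, -, h₁N, h₂N, -, -⟩ := hLamN
  have h : stateCurve Λ₁N Λ₂N SN p.T - stateCurve Λ₁ Λ₂ S p.T =
      ((1 / (N : ℝ)) • (of.symm p.QfΓ : Fin n → Fin n → ℝ), 0, 0) := by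
    simp only [stateCurve, h₁, h₂, h₁N, h₂N, hSr.1, hSrN.1, Prod.mk_sub_mk, sub_self]
    congr 1
    exact add_sub_cancel_left (G := Fin n → Fin n → ℝ) _ _
  rw [h, Prod.norm_mk, Prod.norm_mk, norm_zero, norm_zero, max_self,
    max_eq_left (norm_nonneg _), norm_smul, Real.norm_of_nonneg (by positivity), mul_comm]

/-- The Frobenius distance is bounded by a multiple of the entrywise sup distance. -/
theorem frob_sub_le_norm_sub {a b : ℕ} {M K : Matrix (Fin a) (Fin b) ℝ} {c : ℝ}
    (h : ‖(of.symm M - of.symm K : Fin a → Fin b → ℝ)‖ ≤ c) :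
    frob (M - K) ≤ Real.sqrt (a * b) * c := by
  have hc : 0 ≤ c := (norm_nonneg _).trans h
  simpa using frob_le_of_forall_abs_le (M := M - K) hc fun i j =>
    ((norm_le_pi_norm ((of.symm M - of.symm K : Fin a → Fin b → ℝ) i) j).trans
      (norm_le_pi_norm (of.symm M - of.symm K : Fin a → Fin b → ℝ) i)).trans h

end Params

/-- O(1/N) convergence of the feedback gains (Θ^N, Θ₁^N, Θ₂^N) to
(Θ, Θ₁, Θ₂). -/
theorem gains_converge {n n₁ : ℕ} (p : Params n n₁) (hp : p.Standing)
    (Λ₁ Λ₂ : ℝ → Matrix (Fin n) (Fin n) ℝ)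
    (S : ℝ → Matrix (Fin n) (Fin 1) ℝ) (r : ℝ → ℝ)
    (hLim : p.IsSolLim Λ₁ Λ₂) (hSr : p.IsSolSr Λ₁ Λ₂ S r) :
    ∃ N₁ : ℕ, 1 ≤ N₁ ∧ ∃ C : ℝ, 0 < C ∧
      ∀ N : ℕ, N₁ ≤ N →
        ∀ (Λ₁N Λ₂N : ℝ → Matrix (Fin n) (Fin n) ℝ)
          (SN : ℝ → Matrix (Fin n) (Fin 1) ℝ) (rN : ℝ → ℝ),
          p.IsSolLamN N Λ₁N Λ₂N → p.IsSolSrN N Λ₁N Λ₂N SN rN →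
          ∀ t ∈ Icc (0 : ℝ) p.T,
            frob (p.ThetaN N (Λ₁N t) (Λ₂N t) - p.Theta (Λ₁ t))
            + frob (p.Theta1N N (Λ₁N t) (Λ₂N t) - p.Theta1 (Λ₁ t) (Λ₂ t))
            + frob (p.Theta2N N (Λ₁N t) (Λ₂N t) (SN t) - p.Theta2 (Λ₁ t) (Λ₂ t) (S t))
              ≤ C / (N : ℝ) := by
  have hx : ∀ t ∈ Icc 0 p.T, HasDerivWithinAt (Params.stateCurve Λ₁ Λ₂ S)
      (p.stateField (0, Params.stateCurve Λ₁ Λ₂ S t)) (Icc 0 p.T) t := by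
    intro t ht
    rw [p.stateField_zero]
    exact Params.hasDerivWithinAt_stateCurve (hLim.2.2.2.2.1 t ht) (hLim.2.2.2.2.2 t ht)
      (hSr.2.2.1 t ht)
  obtain ⟨ε₀, hε₀, C, hC, hbound⟩ := exists_terminal_value_perturbation_bound hx
    (fun t ht => p.contDiffAt_stateField (hLim.2.1 t ht).1 (hLim.2.1 t ht).2 rfl)
    ‖(of.symm p.QfΓ : Fin n → Fin n → ℝ)‖
  obtain ⟨δ, hδ, L, hL, hLip⟩ := exists_uniform_lipschitz_near_curve isCompact_Icc
    (continuousOn_of_hasDerivWithinAt hx)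
    (fun t ht => p.contDiffAt_stateGains (hLim.2.1 t ht).1 (hLim.2.1 t ht).2 rfl)
  have hρ : 0 < min ε₀ (δ / (C + 1)) := by positivity
  obtain ⟨m, hm⟩ := exists_nat_one_div_lt hρ
  set k := 2 * Real.sqrt (n₁ * n) + Real.sqrt (n₁ * (1 : ℕ)) with hk
  refine ⟨m + 1, by omega, k * (L * (C + 1)) + 1, by positivity, ?_⟩
  intro N hN Λ₁N Λ₂N SN rN hLamN hSrN t ht
  have hN0 : N ≠ 0 := by omega
  have hNpos : (0 : ℝ) < N := by positivity
  have hε : 0 < 1 / (N : ℝ) := by positivity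
  have hεle : 1 / (N : ℝ) ≤ min ε₀ (δ / (C + 1)) := by
    refine le_trans ?_ hm.le
    gcongr
    exact_mod_cast hN
  have hε' : (C + 1) * (1 / (N : ℝ)) ≤ δ := by
    have := hεle.trans (min_le_right _ _)
    rwa [le_div_iff₀ (by positivity), mul_comm] at this
  have hy : ∀ t ∈ Icc 0 p.T, HasDerivWithinAt (Params.stateCurve Λ₁N Λ₂N SN)
      (p.stateField (1 / (N : ℝ), Params.stateCurve Λ₁N Λ₂N SN t)) (Icc 0 p.T) t := by
    intro t ht
    rw [p.stateField_one_div hN0]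
    exact Params.hasDerivWithinAt_stateCurve (hLamN.2.2.2.2.1 t ht) (hLamN.2.2.2.2.2 t ht)
      (hSrN.2.2.1 t ht)
  have hdist := hbound _ hε (hεle.trans (min_le_left _ _)) _ hy
    (p.norm_stateCurve_terminal_sub hLim hSr hLamN hSrN) t ht
  have hgain := hLip t ht (1 / (N : ℝ)) (Params.stateCurve Λ₁N Λ₂N SN t)
    (by rw [abs_of_pos hε]; nlinarith) (by linarith)
  rw [p.stateGains_zero, p.stateGains_one_div hN0, abs_of_pos hε] at hgain
  have hle : L * (1 / (N : ℝ) + ‖Params.stateCurve Λ₁N Λ₂N SN t - Params.stateCurve Λ₁ Λ₂ S t‖)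
      ≤ L * (C + 1) * (1 / (N : ℝ)) := by
    rw [mul_assoc]
    gcongr
    linarith
  replace hgain := hgain.trans hle
  rw [Prod.mk_sub_mk, Prod.mk_sub_mk, Prod.norm_mk, Prod.norm_mk, max_le_iff, max_le_iff] at hgain
  obtain ⟨h, h₁, h₂⟩ := hgain
  calc _ ≤ Real.sqrt (n₁ * n) * (L * (C + 1) * (1 / (N : ℝ)))
          + Real.sqrt (n₁ * n) * (L * (C + 1) * (1 / (N : ℝ)))
          + Real.sqrt (n₁ * (1 : ℕ)) * (L * (C + 1) * (1 / (N : ℝ))) :=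
        add_le_add (add_le_add (Params.frob_sub_le_norm_sub h) (Params.frob_sub_le_norm_sub h₁))
          (Params.frob_sub_le_norm_sub h₂)
    _ = k * (L * (C + 1)) * (1 / (N : ℝ)) := by rw [hk]; ring
    _ ≤ (k * (L * (C + 1)) + 1) * (1 / (N : ℝ)) := by gcongr; linarith
    _ = (k * (L * (C + 1)) + 1) / (N : ℝ) := by ring

end LQ
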